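/- Let G = (V,E) be a connected graph of treewidth t on n = |V| vertices (n ≥ 3, t ≥ 1), equipped with arbitrary nonnegative edge weights w. Then the shortest-path metric space (V, d_G) is β-decomposable with β = O(ln(t ln n)). -/

import Mathlib

open Set

/-- The weight of a walk in an edge-weighted graph: the sum of the weights of its edges. -/
def walkWeight {V : Type*} {G : SimpleGraph V} (w : Sym2 V → ℝ) {u v : V}
    (p : G.Walk u v) : ℝ :=
  (p.edges.map w).sum

/-- The shortest-path metric `d_G` of the edge-weighted graph `(G, w)`. -/
noncomputable def graphDist {V : Type*} (G : SimpleGraph V) (w : Sym2 V → ℝ) (u v : V) : ℝ :=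
  sInf {r : ℝ | ∃ p : G.Walk u v, r = walkWeight w p}

/-- `(T, bag)` is a tree decomposition of `G`: `T` is a tree, every vertex of `G` lies in
some bag, both endpoints of every edge of `G` lie in a common bag, and for every vertex
`v` of `G` the tree nodes whose bags contain `v` form a (connected) subtree of `T`. -/
def IsTreeDecomposition {V ι : Type*} (G : SimpleGraph V) (T : SimpleGraph ι)
    (bag : ι → Finset V) : Prop :=
  T.IsTree ∧
  (∀ v : V, ∃ i, v ∈ bag i) ∧
  (∀ u v : V, G.Adj u v → ∃ i, u ∈ bag i ∧ v ∈ bag i) ∧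
  (∀ (v : V) (i j : ι), v ∈ bag i → v ∈ bag j →
    ∃ q : T.Walk i j, ∀ x ∈ q.support, v ∈ bag x)

/-- `G` admits a tree decomposition of width at most `t` (all bags of size at most `t+1`). -/
def HasTreewidthLE {V : Type*} (G : SimpleGraph V) (t : ℕ) : Prop :=
  ∃ (ι : Type) (T : SimpleGraph ι) (bag : ι → Finset V),
    IsTreeDecomposition G T bag ∧ ∀ i, (bag i).card ≤ t + 1

/-- The treewidth of `G`: the least width of a tree decomposition of `G`. -/
noncomputable def treewidth {V : Type*} (G : SimpleGraph V) : ℕ :=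
  sInf {t | HasTreewidthLE G t}

/-- `β`-decomposability (Abraham et al.) of the space `X` with distance function `d`. -/
def IsBetaDecomposable {X : Type*} (d : X → X → ℝ) (β : ℝ) : Prop :=
  ∀ Δ : ℝ, 0 < Δ →
    ∃ μ : PMF {P : Set (Set X) // Setoid.IsPartition P},
      (∀ P ∈ μ.support, ∀ S ∈ P.1, ∀ x ∈ S, ∀ y ∈ S, d x y ≤ Δ) ∧
      ∀ (x : X) (γ : ℝ), 0 ≤ γ → γ ≤ 1 / 100 →
        ENNReal.ofReal ((2 : ℝ) ^ (-(β * γ))) ≤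
          μ.toOuterMeasure {P | ∀ S ∈ P.1, x ∈ S → {y | d x y ≤ γ * Δ} ⊆ S}

/-- A set of nodes of `T` is path-convex if every path of `T` between two of its members
stays inside it. -/
def IsPathConvex {ι : Type*} (T : SimpleGraph ι) (A : Set ι) : Prop :=
  ∀ i ∈ A, ∀ j ∈ A, ∀ q : T.Walk i j, q.IsPath → ∀ x ∈ q.support, x ∈ A

theorem IsPathConvex.inter {ι : Type*} {T : SimpleGraph ι} {A B : Set ι}
    (hA : IsPathConvex T A) (hB : IsPathConvex T B) : IsPathConvex T (A ∩ B) :=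
  fun i hi j hj q hq x hx =>
    ⟨hA i hi.1 j hj.1 q hq x hx, hB i hi.2 j hj.2 q hq x hx⟩

theorem SimpleGraph.IsAcyclic.isPathConvex {ι : Type*} {T : SimpleGraph ι} (hT : T.IsAcyclic)
    {A : Set ι} (h : ∀ i ∈ A, ∀ j ∈ A, ∃ q : T.Walk i j, ∀ x ∈ q.support, x ∈ A) :
    IsPathConvex T A := by
  classical
  intro i hi j hj q hq x hx
  obtain ⟨p, hp⟩ := h i hi j hj
  have h1 := (hT.subsingleton_path i j).elim ⟨q, hq⟩ ⟨p.bypass, p.bypass_isPath⟩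
  rw [Subtype.mk.injEq] at h1
  subst h1
  exact hp x (p.support_bypass_subset_support hx)

/-- A path from `B` to `A` meets `A ∩ B` as soon as `A` and `B` intersect. -/
theorem SimpleGraph.IsTree.exists_mem_support_inter {ι : Type*} {T : SimpleGraph ι}
    (hT : T.IsTree) {A B : Set ι} (hA : IsPathConvex T A) (hB : IsPathConvex T B)
    {c : ι} (hcA : c ∈ A) (hcB : c ∈ B) {a b : ι} (p : T.Walk a b) (hp : p.IsPath)
    (ha : a ∈ B) (hb : b ∈ A) : ∃ m ∈ p.support, m ∈ A ∩ B := by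
  classical
  induction p with
  | nil => exact ⟨_, by simp, hb, ha⟩
  | @cons u v w h p ih =>
    by_cases hu : u ∈ A
    · exact ⟨u, by simp, hu, ha⟩
    obtain ⟨hp', hup⟩ := (SimpleGraph.Walk.cons_isPath_iff _ _).1 hp
    obtain ⟨r, hr, -⟩ := hT.existsUnique_path w c
    have hur : u ∉ (p.append r).bypass.support := fun hm => by
      have hm := SimpleGraph.Walk.support_bypass_subset_support _ hm
      rw [SimpleGraph.Walk.mem_support_append_iff] at hm
      exact hm.elim hup fun hm => hu (hA w hb c hcA r hr u hm)
    have hv : v ∈ B := hB u ha c hcB (.cons h (p.append r).bypass)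
      ((SimpleGraph.Walk.cons_isPath_iff _ _).2 ⟨SimpleGraph.Walk.bypass_isPath _, hur⟩)
      v (by simp)
    obtain ⟨m, hm, hm'⟩ := ih hp' hv hb
    exact ⟨m, by simp [hm], hm'⟩

theorem SimpleGraph.IsTree.inter_inter_nonempty {ι : Type*} {T : SimpleGraph ι}
    (hT : T.IsTree) {A B C : Set ι} (hA : IsPathConvex T A) (hB : IsPathConvex T B)
    (hC : IsPathConvex T C) (hAB : (A ∩ B).Nonempty) (hBC : (B ∩ C).Nonempty)
    (hAC : (A ∩ C).Nonempty) : (A ∩ B ∩ C).Nonempty := by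
  obtain ⟨c, hcA, hcB⟩ := hAB
  obtain ⟨a, haB, haC⟩ := hBC
  obtain ⟨b, hbA, hbC⟩ := hAC
  obtain ⟨p, hp, -⟩ := hT.existsUnique_path a b
  obtain ⟨m, hm, hm'⟩ := hT.exists_mem_support_inter hA hB hcA hcB p hp haB hbA
  exact ⟨m, hm', hC a haC b hbC p hp m hm⟩

/-- The Helly property of subtrees of a tree. -/
theorem SimpleGraph.IsTree.helly {ι κ : Type*} {T : SimpleGraph ι} (hT : T.IsTree)
    (s : Finset κ) {A : κ → Set ι} (hA : ∀ k ∈ s, IsPathConvex T (A k))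
    (hAA : ∀ k ∈ s, ∀ l ∈ s, (A k ∩ A l).Nonempty) :
    ∃ i, ∀ k ∈ s, i ∈ A k := by
  classical
  suffices H : ∀ B : Set ι, IsPathConvex T B → B.Nonempty →
      (∀ k ∈ s, (B ∩ A k).Nonempty) → ∃ i ∈ B, ∀ k ∈ s, i ∈ A k by
    obtain ⟨i, -, hi⟩ := H Set.univ (fun _ _ _ _ _ _ _ _ => Set.mem_univ _)
      (have := hT.connected.nonempty; Set.univ_nonempty)
      fun k hk => by simpa using hAA k hk k hk
    exact ⟨i, hi⟩
  induction s using Finset.induction_on with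
  | empty => exact fun B _ ⟨i, hi⟩ _ => ⟨i, hi, by simp⟩
  | insert a s ha ih =>
    intro B hB _ hBA
    simp only [Finset.mem_insert, forall_eq_or_imp] at hA hAA hBA ⊢
    obtain ⟨i, hi, hi'⟩ := ih hA.2 (fun k hk l hl => (hAA.2 k hk).2 l hl) (B ∩ A a)
      (hB.inter hA.1) hBA.1 fun k hk =>
        hT.inter_inter_nonempty hB hA.1 (hA.2 k hk) hBA.1 (hAA.1.2 k hk) (hBA.2 k hk)
    exact ⟨i, hi.1, hi.2, hi'⟩

/-- The nodes whose bags meet a connected set of vertices form a subtree. -/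
theorem IsTreeDecomposition.isPathConvex {V ι : Type*} {G : SimpleGraph V}
    {T : SimpleGraph ι} {bag : ι → Finset V} (h : IsTreeDecomposition G T bag) {K : Set V}
    (hK : ∀ u ∈ K, ∀ v ∈ K, ∃ p : G.Walk u v, ∀ x ∈ p.support, x ∈ K) :
    IsPathConvex T {i | ∃ v ∈ K, v ∈ bag i} := by
  obtain ⟨hT, -, hE, hS⟩ := h
  have H : ∀ {u v : V} (p : G.Walk u v), (∀ x ∈ p.support, x ∈ K) → ∀ i j, u ∈ bag i →
      v ∈ bag j → ∃ q : T.Walk i j, ∀ x ∈ q.support, ∃ v ∈ K, v ∈ bag x := by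
    intro u v p
    induction p with
    | @nil u =>
      intro hp i j hi hj
      obtain ⟨q, hq⟩ := hS u i j hi hj
      exact ⟨q, fun x hx => ⟨u, hp u (by simp), hq x hx⟩⟩
    | @cons u v w huv p ih =>
      intro hp i j hi hj
      obtain ⟨k, hku, hkv⟩ := hE u v huv
      obtain ⟨q, hq⟩ := hS u i k hi hku
      obtain ⟨r, hr⟩ := ih (fun x hx => hp x (by simp [hx])) k j hkv hj
      refine ⟨q.append r, fun x hx => ?_⟩
      rw [SimpleGraph.Walk.mem_support_append_iff] at hx
      exact hx.elim (fun hx => ⟨u, hp u (by simp), hq x hx⟩) (hr x)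
  refine hT.isAcyclic.isPathConvex ?_
  rintro i ⟨u, hu, hui⟩ j ⟨v, hv, hvj⟩
  obtain ⟨p, hp⟩ := hK u hu v hv
  exact H p hp i j hui hvj

/-- Some bag of a tree decomposition is a balanced separator of a given vertex set. -/
theorem IsTreeDecomposition.exists_balanced {V ι : Type*} {G : SimpleGraph V}
    {T : SimpleGraph ι} {bag : ι → Finset V} (h : IsTreeDecomposition G T bag)
    (U : Finset V) :
    ∃ i, ∀ K ⊆ U, (∀ u ∈ K, ∀ v ∈ K, ∃ p : G.Walk u v, ∀ x ∈ p.support, x ∈ K) →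
      Disjoint K (bag i) → 2 * K.card ≤ U.card := by
  classical
  let s : Finset (Finset V) := {K ∈ U.powerset |
    (∀ u ∈ K, ∀ v ∈ K, ∃ p : G.Walk u v, ∀ x ∈ p.support, x ∈ K) ∧ U.card < 2 * K.card}
  obtain ⟨i, hi⟩ := h.1.helly s (A := fun K => {i | ∃ v ∈ K, v ∈ bag i})
    (fun K hK => h.isPathConvex (K := (K : Set V)) (Finset.mem_filter.1 hK).2.1) (by
      intro K hK L hL
      obtain ⟨hKU, -, hK⟩ := Finset.mem_filter.1 hK
      obtain ⟨hLU, -, hL⟩ := Finset.mem_filter.1 hL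
      obtain ⟨v, hv⟩ := Finset.inter_nonempty_of_card_lt_card_add_card
        (Finset.mem_powerset.1 hKU) (Finset.mem_powerset.1 hLU) (by omega)
      rw [Finset.mem_inter] at hv
      obtain ⟨i, hi⟩ := h.2.1 v
      exact ⟨i, ⟨v, hv.1, hi⟩, ⟨v, hv.2, hi⟩⟩)
  refine ⟨i, fun K hKU hK hd => ?_⟩
  by_contra! hlt
  obtain ⟨v, hv, hv'⟩ := hi K (Finset.mem_filter.2 ⟨Finset.mem_powerset.2 hKU, hK, hlt⟩)
  exact Finset.disjoint_left.1 hd hv hv'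

/-- Recursively separating along balanced bags assigns to every vertex a short list of
separator vertices, such that every walk meets the common prefix of the lists of its ends. -/
theorem IsTreeDecomposition.exists_separator_lists {V ι : Type*} {G : SimpleGraph V}
    {T : SimpleGraph ι} {bag : ι → Finset V} (h : IsTreeDecomposition G T bag) {k : ℕ}
    (hk : ∀ i, (bag i).card ≤ k) (m : ℕ) (U : Finset V) (hU : U.card < 2 ^ m) :
    ∃ L : V → List V, (∀ x, (L x).Nodup ∧ (L x).length ≤ k * m ∧ ∀ s ∈ L x, s ∈ U) ∧
      ∀ x y (p : G.Walk x y), (∀ z ∈ p.support, z ∈ U) →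
        ∃ A, A <+: L x ∧ A <+: L y ∧ ∃ s ∈ A, s ∈ p.support := by
  classical
  induction m generalizing U with
  | zero =>
    obtain rfl : U = ∅ := by simpa using hU
    exact ⟨fun _ => [], by simp, fun x y p hp => by simpa using hp x (by simp)⟩
  | succ m ih =>
    obtain ⟨i, hi⟩ := h.exists_balanced U
    let comp : V → Finset V := fun x =>
      {y ∈ U | ∃ p : G.Walk x y, ∀ z ∈ p.support, z ∈ U \ bag i}
    have hcompU : ∀ x, comp x ⊆ U \ bag i := fun x y hy => by
      obtain ⟨-, p, hp⟩ := Finset.mem_filter.1 hy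
      exact hp y (by simp)
    have hcomp : ∀ x y, y ∈ comp x ↔ ∃ p : G.Walk x y, ∀ z ∈ p.support, z ∈ U \ bag i := by
      intro x y
      refine ⟨fun hy => (Finset.mem_filter.1 hy).2, fun ⟨p, hp⟩ =>
        Finset.mem_filter.2 ⟨(Finset.mem_sdiff.1 (hp y (by simp))).1, p, hp⟩⟩
    have hcomp_eq : ∀ x y, y ∈ comp x → comp y = comp x := by
      intro x y hy
      obtain ⟨p, hp⟩ := (hcomp x y).1 hy
      ext z
      rw [hcomp, hcomp]
      constructor
      · rintro ⟨q, hq⟩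
        refine ⟨p.append q, fun a ha => ?_⟩
        rw [SimpleGraph.Walk.mem_support_append_iff] at ha
        exact ha.elim (hp a) (hq a)
      · rintro ⟨q, hq⟩
        refine ⟨p.reverse.append q, fun a ha => ?_⟩
        rw [SimpleGraph.Walk.mem_support_append_iff, SimpleGraph.Walk.support_reverse,
          List.mem_reverse] at ha
        exact ha.elim (hp a) (hq a)
    have hwalk : ∀ x y (p : G.Walk x y), (∀ z ∈ p.support, z ∈ U \ bag i) →
        ∀ z ∈ p.support, z ∈ comp x := fun x y p hp z hz =>
      (hcomp x z).2 ⟨p.takeUntil z hz, fun a ha =>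
        hp a (p.support_takeUntil_subset_support hz ha)⟩
    have hcard : ∀ x, (comp x).card < 2 ^ m := by
      intro x
      have h1 := hi (comp x) ((hcompU x).trans Finset.sdiff_subset) (by
        intro u hu v hv
        rw [← hcomp_eq x u hu] at hv ⊢
        obtain ⟨p, hp⟩ := (hcomp u v).1 hv
        exact ⟨p, hwalk u v p hp⟩)
        (Finset.disjoint_of_subset_left (hcompU x) Finset.sdiff_disjoint)
      rw [pow_succ] at hU
      omega
    have ih' : ∀ K : Finset V, ∃ L : V → List V, K.card < 2 ^ m →
        (∀ x, (L x).Nodup ∧ (L x).length ≤ k * m ∧ ∀ s ∈ L x, s ∈ K) ∧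
        ∀ x y (p : G.Walk x y), (∀ z ∈ p.support, z ∈ K) →
          ∃ A, A <+: L x ∧ A <+: L y ∧ ∃ s ∈ A, s ∈ p.support := fun K => by
      by_cases hK : K.card < 2 ^ m
      · obtain ⟨L, hL⟩ := ih K hK
        exact ⟨L, fun _ => hL⟩
      · exact ⟨fun _ => [], fun h => absurd h hK⟩
    choose L' hL' using ih'
    have hL'x := fun x => (hL' (comp x) (hcard x)).1 x
    refine ⟨fun x => (bag i ∩ U).toList ++ L' (comp x) x, fun x => ⟨?_, ?_, ?_⟩, ?_⟩
    · refine List.nodup_append'.2 ⟨Finset.nodup_toList _, (hL'x x).1, fun s hs hs' => ?_⟩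
      have h1 := Finset.mem_sdiff.1 (hcompU x ((hL'x x).2.2 s hs'))
      exact h1.2 (Finset.mem_inter.1 (Finset.mem_toList.1 hs)).1
    · have h1 : (bag i ∩ U).card ≤ k := (Finset.card_le_card Finset.inter_subset_left).trans (hk i)
      have h2 := (hL'x x).2.1
      rw [List.length_append, Finset.length_toList, mul_add]
      omega
    · intro s hs
      rw [List.mem_append, Finset.mem_toList] at hs
      exact hs.elim (fun hs => (Finset.mem_inter.1 hs).2)
        fun hs => (Finset.mem_sdiff.1 (hcompU x ((hL'x x).2.2 s hs))).1
    · intro x y p hp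
      by_cases hps : ∃ s ∈ p.support, s ∈ bag i
      · obtain ⟨s, hs, hsi⟩ := hps
        exact ⟨_, List.prefix_append _ _, List.prefix_append _ _, s,
          by simp [hsi, hp s hs], hs⟩
      · push Not at hps
        have hp' := hwalk x y p fun z hz => Finset.mem_sdiff.2 ⟨hp z hz, hps z hz⟩
        obtain ⟨A, hAx, hAy, hA⟩ := (hL' (comp x) (hcard x)).2 x y p hp'
        refine ⟨(bag i ∩ U).toList ++ A, (List.prefix_append_right_inj _).2 hAx, ?_, ?_⟩
        · beta_reduce
          rw [hcomp_eq x y (hp' y (by simp))]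
          exact (List.prefix_append_right_inj _).2 hAy
        · obtain ⟨s, hs, hs'⟩ := hA
          exact ⟨s, by simp [hs], hs'⟩

/-- The tail of the exponential law of rate `lam` truncated to `[0, R]`. -/
noncomputable def truncExpTail (lam R a : ℝ) : unitInterval :=
  Set.projIcc 0 1 zero_le_one
    ((Real.exp (-(lam * a)) - Real.exp (-(lam * R))) / (1 - Real.exp (-(lam * R))))

theorem truncExpTail_antitone {lam R : ℝ} (hl : 0 ≤ lam) (hR : 0 ≤ R) :
    Antitone (truncExpTail lam R) := by
  intro a b hab
  have : Real.exp (-(lam * R)) ≤ 1 := Real.exp_le_one_iff.2 (by nlinarith)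
  refine Set.monotone_projIcc _ ?_
  have : 0 ≤ 1 - Real.exp (-(lam * R)) := by linarith
  gcongr

theorem truncExpTail_eq_one {lam R a : ℝ} (hl : 0 < lam) (hR : 0 < R) (ha : a ≤ 0) :
    truncExpTail lam R a = 1 := by
  have h1 : Real.exp (-(lam * R)) < 1 := Real.exp_lt_one_iff.2 (by nlinarith [mul_pos hl hR])
  refine Set.projIcc_of_right_le _ ?_
  have h2 : 1 ≤ Real.exp (-(lam * a)) := Real.one_le_exp (by nlinarith)
  rw [le_div_iff₀ (by linarith)]
  linarith

theorem truncExpTail_eq_zero {lam R a : ℝ} (hl : 0 < lam) (hR : 0 < R) (ha : R ≤ a) :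
    truncExpTail lam R a = 0 := by
  have h1 : Real.exp (-(lam * R)) < 1 := Real.exp_lt_one_iff.2 (by nlinarith [mul_pos hl hR])
  refine Set.projIcc_of_le_left _ (div_nonpos_of_nonpos_of_nonneg ?_ (by linarith))
  rw [sub_nonpos, Real.exp_le_exp]
  nlinarith

theorem le_truncExpTail_add {lam R h : ℝ} (hl : 0 < lam) (hR : 0 < R) (hh : 0 ≤ h) (a : ℝ) :
    Real.exp (-(lam * h)) * truncExpTail lam R a -
        (1 - Real.exp (-(lam * h))) * (Real.exp (lam * R) - 1)⁻¹ ≤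
      truncExpTail lam R (a + h) := by
  have h1 : Real.exp (-(lam * R)) < 1 := Real.exp_lt_one_iff.2 (by nlinarith [mul_pos hl hR])
  have hq0 := Real.exp_pos (-(lam * h))
  have hq1 : Real.exp (-(lam * h)) ≤ 1 := Real.exp_le_one_iff.2 (by nlinarith)
  have hη : (Real.exp (lam * R) - 1)⁻¹ =
      Real.exp (-(lam * R)) / (1 - Real.exp (-(lam * R))) := by
    rw [Real.exp_neg] at h1 ⊢
    have := Real.exp_pos (lam * R)
    have : Real.exp (lam * R) - 1 ≠ 0 := by
      have : 1 < Real.exp (lam * R) := Real.one_lt_exp_iff.2 (mul_pos hl hR)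
      linarith
    field_simp
  have hη0 : 0 ≤ (1 - Real.exp (-(lam * h))) * (Real.exp (lam * R) - 1)⁻¹ := by
    rw [hη]
    exact mul_nonneg (by linarith) (div_nonneg (Real.exp_pos _).le (by linarith))
  have key : (Real.exp (-(lam * (a + h))) - Real.exp (-(lam * R))) / (1 - Real.exp (-(lam * R))) =
      Real.exp (-(lam * h)) *
        ((Real.exp (-(lam * a)) - Real.exp (-(lam * R))) / (1 - Real.exp (-(lam * R)))) -
      (1 - Real.exp (-(lam * h))) * (Real.exp (lam * R) - 1)⁻¹ := by
    rw [hη, mul_add, neg_add, Real.exp_add]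
    field_simp
    ring
  rw [truncExpTail, truncExpTail, Set.coe_projIcc, Set.coe_projIcc, key]
  set g := (Real.exp (-(lam * a)) - Real.exp (-(lam * R))) / (1 - Real.exp (-(lam * R)))
  set c := (1 - Real.exp (-(lam * h))) * (Real.exp (lam * R) - 1)⁻¹
  set q := Real.exp (-(lam * h))
  rcases le_total g 0 with hg | hg
  · rw [max_eq_left (min_le_of_right_le hg)]
    exact le_max_of_le_left (by linarith)
  · rw [max_eq_right (le_min zero_le_one hg)]
    refine le_max_of_le_right (le_min ?_ ?_)
    · nlinarith [min_le_left 1 g]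
    · nlinarith [min_le_right 1 g]

/-- For lists of independent uniform variables: the event that every variable of the list that
comes before the first one lying below its `b`-threshold lies above its `a`-threshold. -/
def uncutEvent {V : Type*} (a b : V → unitInterval) : List V → Set (V → unitInterval)
  | [] => Set.univ
  | s :: l => ({ω | a s < ω s} ∩ uncutEvent a b l) ∪ {ω | ω s < b s}

open MeasureTheory in
theorem measurableSet_uncutEvent {V : Type*} (a b : V → unitInterval) (l : List V)
    {S : Set V} (hl : ∀ s ∈ l, s ∈ S) :
    MeasurableSet[⨆ s ∈ S, MeasurableSpace.comap (fun ω : V → unitInterval => ω s) inferInstance]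
      (uncutEvent a b l) := by
  induction l with
  | nil => exact @MeasurableSet.univ _ _
  | cons s l ih =>
    simp only [List.mem_cons, forall_eq_or_imp] at hl
    have hs : ∀ B : Set unitInterval, MeasurableSet B → MeasurableSet[⨆ s ∈ S,
        MeasurableSpace.comap (fun ω : V → unitInterval => ω s) inferInstance] {ω | ω s ∈ B} :=
      fun B hB => le_iSup₂ (f := fun s (_ : s ∈ S) =>
        MeasurableSpace.comap (fun ω : V → unitInterval => ω s) inferInstance) s hl.1 _ ⟨B, hB, rfl⟩
    exact @MeasurableSet.union _ _ _ _
      (@MeasurableSet.inter _ _ _ _ (hs (Set.Ioi (a s)) measurableSet_Ioi) (ih hl.2))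
      (hs (Set.Iio (b s)) measurableSet_Iio)

open MeasureTheory ProbabilityTheory in
theorem le_real_uncutEvent {V : Type*} [Fintype V] {a b : V → unitInterval} (hba : ∀ s, b s ≤ a s)
    {q c : ℝ} (hq : q ≤ 1) (hc : 0 ≤ c)
    (hab : ∀ s, q * a s - c ≤ b s) (l : List V) (hl : l.Nodup) :
    q - l.length * c ≤
      (Measure.pi fun _ : V => (volume : Measure unitInterval)).real (uncutEvent a b l) := by
  set μ := Measure.pi fun _ : V => (volume : Measure unitInterval)
  induction l with
  | nil => simpa [uncutEvent] using hq
  | cons s l ih =>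
    obtain ⟨hsl, hl⟩ := List.nodup_cons.1 hl
    have ih := ih hl
    have hmeas : ∀ t (B : Set unitInterval), MeasurableSet B →
        μ.real {ω | ω t ∈ B} = volume.real B := fun t B hB =>
      (measurePreserving_eval _ t).measureReal_preimage hB.nullMeasurableSet
    have hindep : iIndep (fun t : V =>
        MeasurableSpace.comap (fun ω : V → unitInterval => ω t) inferInstance) μ :=
      iIndepFun_pi (X := fun _ => id) (fun _ => aemeasurable_id)
    have hind := indep_iSup_of_disjoint (fun t => (measurable_pi_apply t).comap_le) hindep
      (S := {s}) (T := {t | t ∈ l}) (by simpa using hsl)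
    have hA : MeasurableSet {ω : V → unitInterval | a s < ω s} :=
      measurableSet_lt measurable_const (measurable_pi_apply s)
    have hB : MeasurableSet {ω : V → unitInterval | ω s < b s} :=
      measurableSet_lt (measurable_pi_apply s) measurable_const
    have h1 : μ ({ω | a s < ω s} ∩ uncutEvent a b l) =
        μ {ω | a s < ω s} * μ (uncutEvent a b l) := by
      refine (Indep_iff _ _ _).1 hind _ _ ?_ (measurableSet_uncutEvent a b l fun t ht => ht)
      rw [iSup_singleton]
      exact ⟨Set.Ioi (a s), measurableSet_Ioi, rfl⟩
    have h2 : μ.real (uncutEvent a b (s :: l)) =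
        μ.real {ω | a s < ω s} * μ.real (uncutEvent a b l) + μ.real {ω | ω s < b s} := by
      rw [uncutEvent, measureReal_union _ hB, measureReal_def, h1, ENNReal.toReal_mul]
      · rfl
      · refine Set.disjoint_left.2 fun ω hω hω' => ?_
        exact absurd (hω.1.trans (lt_of_lt_of_le hω' (hba s))) (lt_irrefl _)
    have h3 : μ.real {ω | a s < ω s} = 1 - a s := by
      refine (hmeas s (Set.Ioi (a s)) measurableSet_Ioi).trans ?_
      rw [measureReal_def, unitInterval.volume_Ioi, ENNReal.toReal_ofReal]
      exact unitInterval.one_minus_nonneg _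
    have h4 : μ.real {ω | ω s < b s} = b s := by
      refine (hmeas s (Set.Iio (b s)) measurableSet_Iio).trans ?_
      rw [measureReal_def, unitInterval.volume_Iio, ENNReal.toReal_ofReal]
      exact unitInterval.nonneg _
    rw [h2, h3, h4, List.length_cons]
    push_cast
    have := hab s
    have h5 := mul_le_mul_of_nonneg_left ih (unitInterval.one_minus_nonneg (a s))
    have h6 : 0 ≤ (a s : ℝ) * (l.length * c) := mul_nonneg (unitInterval.nonneg _) (by positivity)
    nlinarith

theorem walkWeight_nonneg {V : Type*} {G : SimpleGraph V} {w : Sym2 V → ℝ}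
    (hw : ∀ e, 0 ≤ w e) {u v : V} (p : G.Walk u v) : 0 ≤ walkWeight w p :=
  List.sum_nonneg fun _ hx => by
    obtain ⟨e, -, rfl⟩ := List.mem_map.1 hx
    exact hw e

theorem walkWeight_append {V : Type*} {G : SimpleGraph V} (w : Sym2 V → ℝ) {u v x : V}
    (p : G.Walk u v) (q : G.Walk v x) :
    walkWeight w (p.append q) = walkWeight w p + walkWeight w q := by
  simp [walkWeight]

theorem graphDist_le_walkWeight {V : Type*} {G : SimpleGraph V} {w : Sym2 V → ℝ}
    (hw : ∀ e, 0 ≤ w e) {u v : V} (p : G.Walk u v) : graphDist G w u v ≤ walkWeight w p :=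
  csInf_le ⟨0, by rintro _ ⟨q, rfl⟩; exact walkWeight_nonneg hw q⟩ ⟨p, rfl⟩

theorem exists_walkWeight_lt {V : Type*} {G : SimpleGraph V} (hG : G.Connected)
    {w : Sym2 V → ℝ} {u v : V} {r : ℝ} (hr : graphDist G w u v < r) :
    ∃ p : G.Walk u v, walkWeight w p < r := by
  obtain ⟨q⟩ := hG u v
  obtain ⟨_, ⟨p, rfl⟩, hp⟩ := exists_lt_of_csInf_lt (s := {r | ∃ p : G.Walk u v, r = walkWeight w p})
    ⟨_, q, rfl⟩ hr
  exact ⟨p, hp⟩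

theorem graphDist_nonneg {V : Type*} {G : SimpleGraph V} {w : Sym2 V → ℝ}
    (hw : ∀ e, 0 ≤ w e) (u v : V) : 0 ≤ graphDist G w u v :=
  Real.sInf_nonneg (by rintro _ ⟨q, rfl⟩; exact walkWeight_nonneg hw q)

theorem graphDist_self {V : Type*} {G : SimpleGraph V} {w : Sym2 V → ℝ}
    (hw : ∀ e, 0 ≤ w e) (u : V) : graphDist G w u u = 0 :=
  le_antisymm ((graphDist_le_walkWeight hw .nil).trans_eq (by simp [walkWeight]))
    (graphDist_nonneg hw u u)

theorem graphDist_comm {V : Type*} {G : SimpleGraph V} {w : Sym2 V → ℝ} (u v : V) :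
    graphDist G w u v = graphDist G w v u := by
  refine congrArg sInf (Set.ext fun r => ⟨?_, ?_⟩) <;>
  · rintro ⟨p, rfl⟩
    exact ⟨p.reverse, by simp [walkWeight]⟩

theorem graphDist_triangle {V : Type*} {G : SimpleGraph V} (hG : G.Connected) {w : Sym2 V → ℝ}
    (hw : ∀ e, 0 ≤ w e) (u v x : V) :
    graphDist G w u x ≤ graphDist G w u v + graphDist G w v x := by
  refine le_of_forall_pos_lt_add fun ε hε => ?_
  obtain ⟨p, hp⟩ := exists_walkWeight_lt hG (lt_add_of_pos_right (graphDist G w u v) (half_pos hε))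
  obtain ⟨q, hq⟩ := exists_walkWeight_lt hG (lt_add_of_pos_right (graphDist G w v x) (half_pos hε))
  have := graphDist_le_walkWeight hw (p.append q)
  rw [walkWeight_append] at this
  linarith

/-- In a finite graph some walk between `u` and `v` stays in the ball around `u` through `v`. -/
theorem exists_walk_graphDist_le {V : Type*} [Finite V] {G : SimpleGraph V} (hG : G.Connected)
    {w : Sym2 V → ℝ} (hw : ∀ e, 0 ≤ w e) (u v : V) :
    ∃ p : G.Walk u v, ∀ s ∈ p.support, graphDist G w u s ≤ graphDist G w u v := by
  classical
  have h : ∀ s, ∃ ε > 0, graphDist G w u s < graphDist G w u v + ε →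
      graphDist G w u s ≤ graphDist G w u v := fun s => by
    by_cases hs : graphDist G w u s ≤ graphDist G w u v
    · exact ⟨1, one_pos, fun _ => hs⟩
    · exact ⟨graphDist G w u s - graphDist G w u v, by linarith, fun h => by linarith⟩
  choose ε hε hs using h
  have : Nonempty V := ⟨u⟩
  obtain ⟨m, hm⟩ := Finite.exists_min ε
  obtain ⟨p, hp⟩ := exists_walkWeight_lt hG (lt_add_of_pos_right (graphDist G w u v) (hε m))
  refine ⟨p, fun s hsp => hs s ?_⟩
  have h1 := congrArg (walkWeight w) (p.take_spec hsp)
  rw [walkWeight_append] at h1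
  have := graphDist_le_walkWeight hw (p.takeUntil s hsp)
  have := walkWeight_nonneg hw (p.dropUntil s hsp)
  linarith [hm s]

/-- The partition obtained by assigning each `x` to the first element `s` of `L x` with
`c s x = true`, and to `x` itself if there is none. -/
def firstHitPartition {V : Type*} (L : V → List V) (c : V → V → Bool) :
    {P : Set (Set V) // Setoid.IsPartition P} :=
  ⟨(Setoid.ker fun x => ((L x).find? fun s => c s x).getD x).classes, Setoid.isPartition_classes _⟩

theorem find?_eq_of_mem_uncutEvent {V : Type*} {a b : V → unitInterval} {ω : V → unitInterval}
    {l r : List V} (hω : ω ∈ uncutEvent a b (l ++ r)) {s₀ : V} (hs₀ : s₀ ∈ l) (has₀ : a s₀ = 1) :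
    ∃ s, ∀ τ : V → unitInterval, (∀ t, b t ≤ τ t) → (∀ t, τ t ≤ a t) →
      l.find? (fun t => decide (ω t < τ t)) = some s := by
  induction l with
  | nil => simp at hs₀
  | cons t l ih =>
    rcases hω with ⟨h1, h2⟩ | h
    · have hne : s₀ ≠ t := by
        rintro rfl
        exact absurd h1 (by simpa [has₀] using unitInterval.le_one')
      obtain ⟨s, hs⟩ := ih h2 (by simpa [hne] using hs₀)
      refine ⟨s, fun τ hb ha => ?_⟩
      rw [List.find?_cons_of_neg, hs τ hb ha]
      simpa using (ha t).trans (le_of_lt h1)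
    · exact ⟨t, fun τ hb ha => List.find?_cons_of_pos (by simpa using lt_of_lt_of_le h (hb t))⟩

open MeasureTheory in
theorem isBetaDecomposable_of_lists {V : Type*} [Fintype V] {d : V → V → ℝ}
    (hself : ∀ x, d x x = 0) (hcomm : ∀ x y, d x y = d y x)
    (htri : ∀ x y z, d x z ≤ d x y + d y z) (L : V → List V) (hnd : ∀ x, (L x).Nodup)
    {k : ℕ} (hk : 1 ≤ k) (hlen : ∀ x, (L x).length ≤ k)
    (hL : ∀ x y, ∃ A, A <+: L x ∧ A <+: L y ∧ ∃ s ∈ A, d x s ≤ d x y) {β : ℝ}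
    (hβ : 16 * Real.log (k + 1) ≤ β * Real.log 2) : IsBetaDecomposable d β := by
  classical
  intro Δ hΔ
  have hk' : (1 : ℝ) ≤ k := by exact_mod_cast hk
  set lg := Real.log (k + 1) with hlg
  have hlg0 : 0 < lg := Real.log_pos (by linarith)
  have hexp : Real.exp lg = k + 1 := Real.exp_log (by linarith)
  set lam := 4 * lg / Δ with hlam
  have hlam0 : 0 < lam := by positivity
  have hR : 0 < Δ / 2 := by positivity
  set T := truncExpTail lam (Δ / 2)
  have hT : Antitone T := truncExpTail_antitone hlam0.le hR.le
  set μ := Measure.pi fun _ : V => (volume : Measure unitInterval)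
  set c : (V → unitInterval) → V → V → Bool := fun ω s x => decide (ω s < T (d s x)) with hc
  have hcm : Measurable c := measurable_pi_lambda _ fun s => measurable_pi_lambda _ fun x =>
    measurable_to_bool (by
      have : (fun ω : V → unitInterval => c ω s x) ⁻¹' {true} = {ω | ω s < T (d s x)} := by
        ext ω; simp [hc]
      rw [this]
      exact measurableSet_lt (measurable_pi_apply s) measurable_const)
  have : IsProbabilityMeasure (μ.map c) := Measure.isProbabilityMeasure_map hcm.aemeasurable
  refine ⟨(μ.map c).toPMF.map (firstHitPartition L), ?_, ?_⟩
  · intro P hP S hS x hx y hy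
    obtain ⟨f, hf, rfl⟩ := (PMF.mem_support_map_iff _ _ _).1 hP
    obtain ⟨ω, rfl⟩ : ∃ ω, c ω = f := by
      by_contra! hne
      refine (PMF.mem_support_iff _ _).1 hf ?_
      rw [Measure.toPMF_apply, Measure.map_apply hcm (measurableSet_singleton f)]
      convert measure_empty (μ := μ)
      ext ω
      simpa using hne ω
    have hlab : ∀ z, d (((L z).find? fun s => c ω s z).getD z) z ≤ Δ / 2 := by
      intro z
      cases hz : (L z).find? fun s => c ω s z with
      | none => simpa [hself] using hR.le
      | some s =>
        have h1 := List.find?_some hz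
        by_contra! hlt
        rw [hc, decide_eq_true_eq, show T (d s z) = 0 from truncExpTail_eq_zero hlam0 hR hlt.le] at h1
        exact absurd h1 (not_lt.2 (unitInterval.nonneg _))
    obtain ⟨z, rfl⟩ := hS
    have h1 := hlab x
    have h2 := hlab y
    have hxy : ((L x).find? fun s => c ω s x).getD x = ((L y).find? fun s => c ω s y).getD y :=
      Eq.trans hx (Eq.symm hy)
    rw [← hxy] at h2
    rw [hcomm] at h1
    linarith [htri x (((L x).find? fun s => c ω s x).getD x) y]
  · intro x γ hγ0 hγ1
    set h := 2 * γ * Δ with hh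
    have hh0 : 0 ≤ h := by positivity
    set a : V → unitInterval := fun s => T (d s x - γ * Δ)
    set b : V → unitInterval := fun s => T (d s x + γ * Δ)
    set q := Real.exp (-(lam * h)) with hq
    have hlh : lam * h = 8 * γ * lg := by rw [hlam, hh]; field_simp; ring
    have hq1 : q ≤ 1 := Real.exp_le_one_iff.2 (by rw [hlh]; nlinarith [mul_nonneg hγ0 hlg0.le])
    have hη : Real.exp (lam * (Δ / 2)) - 1 = k * (k + 2) := by
      have : lam * (Δ / 2) = lg + lg := by rw [hlam]; field_simp; ring
      rw [this, Real.exp_add, hexp]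
      ring
    have hqk : (k + 1 : ℝ)⁻¹ ≤ q := by
      rw [← hexp, ← Real.exp_neg, hq, hlh, Real.exp_le_exp]
      nlinarith
    have hbound := le_real_uncutEvent (a := a) (b := b) (q := q)
      (c := (1 - q) * (Real.exp (lam * (Δ / 2)) - 1)⁻¹)
      (fun s => hT (by nlinarith)) hq1
      (mul_nonneg (by linarith) (by rw [hη]; positivity))
      (fun s => by
        have h1 := le_truncExpTail_add hlam0 hR hh0 (d s x - γ * Δ)
        rwa [show d s x - γ * Δ + h = d s x + γ * Δ by rw [hh]; ring] at h1) (L x) (hnd x)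
    have hsq : q ^ 2 ≤ μ.real (uncutEvent a b (L x)) := by
      refine le_trans ?_ hbound
      rw [hη]
      have h1 : ((L x).length : ℝ) * ((k : ℝ) * (k + 2))⁻¹ ≤ q := by
        refine le_trans ?_ hqk
        have : ((L x).length : ℝ) ≤ k := by exact_mod_cast hlen x
        calc ((L x).length : ℝ) * ((k : ℝ) * (k + 2))⁻¹
            ≤ k * ((k : ℝ) * (k + 2))⁻¹ := by gcongr
          _ = (k + 2 : ℝ)⁻¹ := by field_simp
          _ ≤ (k + 1 : ℝ)⁻¹ := by gcongr; norm_num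
      nlinarith
    have hpow : (2 : ℝ) ^ (-(β * γ)) ≤ q ^ 2 := by
      rw [Real.rpow_def_of_pos two_pos, hq, ← Real.exp_nat_mul, Real.exp_le_exp, hlh]
      push_cast
      nlinarith
    refine (ENNReal.ofReal_le_ofReal (hpow.trans hsq)).trans ?_
    rw [ofReal_measureReal, PMF.toOuterMeasure_map_apply, ← PMF.toMeasure_apply_eq_toOuterMeasure,
      Measure.toPMF_toMeasure, Measure.map_apply hcm (Set.toFinite _).measurableSet]
    refine measure_mono fun ω hω S hS hxS y hy => ?_
    have hlab : ∀ y, d x y ≤ γ * Δ →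
        ((L x).find? fun s => c ω s x).getD x = ((L y).find? fun s => c ω s y).getD y := by
      intro y hxy
      obtain ⟨A, ⟨r, hr⟩, ⟨r', hr'⟩, s₀, hs₀, hs₀d⟩ := hL x y
      rw [← hr] at hω
      obtain ⟨s, hs⟩ := find?_eq_of_mem_uncutEvent hω hs₀
        (truncExpTail_eq_one hlam0 hR (by rw [hcomm]; linarith))
      have hγΔ : 0 ≤ γ * Δ := by positivity
      have hsx := hs (fun t => T (d t x)) (fun t => hT (by linarith)) (fun t => hT (by linarith))
      have hsy := hs (fun t => T (d t y))
        (fun t => hT (by linarith [htri t x y]))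
        (fun t => hT (by linarith [htri t y x, hcomm x y]))
      rw [← hr, ← hr', List.find?_append, List.find?_append, hsx, hsy]
      rfl
    obtain ⟨z, rfl⟩ := hS
    exact Eq.trans (hlab y hy).symm hxS

theorem HasTreewidthLE.isBetaDecomposable {V : Type*} [Fintype V] {G : SimpleGraph V} {t : ℕ}
    (ht : HasTreewidthLE G t) {w : Sym2 V → ℝ} (hw : ∀ e, 0 ≤ w e) (hG : G.Connected) {β : ℝ}
    (hβ : 16 * Real.log ((t + 1) * (Nat.log 2 (Fintype.card V) + 1) + 1) ≤ β * Real.log 2) :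
    IsBetaDecomposable (graphDist G w) β := by
  obtain ⟨ι, T, bag, h, hcard⟩ := ht
  obtain ⟨L, hL, hLp⟩ := h.exists_separator_lists hcard (Nat.log 2 (Fintype.card V) + 1)
    Finset.univ (Nat.lt_pow_succ_log_self one_lt_two _)
  refine isBetaDecomposable_of_lists (graphDist_self hw) graphDist_comm
    (graphDist_triangle hG hw) L (fun x => (hL x).1)
    (k := (t + 1) * (Nat.log 2 (Fintype.card V) + 1)) (by nlinarith)
    (fun x => (hL x).2.1) (fun x y => ?_) (by exact_mod_cast hβ)
  obtain ⟨p, hp⟩ := exists_walk_graphDist_le hG hw x y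
  obtain ⟨A, hAx, hAy, s, hs, hsp⟩ := hLp x y p fun _ _ => Finset.mem_univ _
  exact ⟨A, hAx, hAy, s, hs, hp s hsp⟩

/-- Every connected graph of treewidth `t ≥ 1` on `n ≥ 3` vertices, with arbitrary
nonnegative edge weights, is `O(ln (t ln n))`-decomposable. -/
theorem treewidth_isBetaDecomposable :
    ∃ C : ℝ, 0 < C ∧
      ∀ (V : Type) [Fintype V], ∀ (G : SimpleGraph V) (w : Sym2 V → ℝ),
        (∀ e, 0 ≤ w e) → G.Connected → 3 ≤ Fintype.card V →
        ∀ t : ℕ, 1 ≤ t → treewidth G = t →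
        IsBetaDecomposable (graphDist G w)
          (C * Real.log ((t : ℝ) * Real.log (Fintype.card V))) := by
  have h3 : 1 < Real.log 3 :=
    (Real.lt_log_iff_exp_lt (by norm_num)).2 (Real.exp_one_lt_d9.trans (by norm_num))
  have hl3 : 0 < Real.log (Real.log 3) := Real.log_pos h3
  have hl2 : 0 < Real.log 2 := Real.log_pos one_lt_two
  have hl7 : 0 < Real.log 7 := Real.log_pos (by norm_num)
  refine ⟨16 * (1 + Real.log 7 / Real.log (Real.log 3)) / Real.log 2, by positivity, ?_⟩
  intro V _ G w hw hG hn t ht htw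
  have hT : HasTreewidthLE G t := by
    rw [← htw]
    exact Nat.sInf_mem (s := {t | HasTreewidthLE G t})
      (Nat.nonempty_of_pos_sInf (by change 0 < treewidth G; omega))
  refine hT.isBetaDecomposable hw hG ?_
  set n := Fintype.card V
  have hn' : (3 : ℝ) ≤ n := by exact_mod_cast hn
  have ht' : (1 : ℝ) ≤ t := by exact_mod_cast ht
  have hln : Real.log 3 ≤ Real.log n := Real.log_le_log (by norm_num) hn'
  have hlog : (Nat.log 2 n : ℝ) ≤ 2 * Real.log n := by
    have h1 := Real.natLog_le_logb n 2
    rw [Real.logb, le_div_iff₀ (by simpa using hl2)] at h1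
    have h2 := Real.log_two_gt_d9
    have h4 : (0 : ℝ) ≤ Nat.log 2 n := by positivity
    push_cast at h1
    nlinarith
  have hy : Real.log 3 ≤ t * Real.log n := by nlinarith
  have harg : ((t : ℝ) + 1) * (Nat.log 2 n + 1) + 1 ≤ 7 * (t * Real.log n) := by
    have h1 : ((t : ℝ) + 1) * (Nat.log 2 n + 1) ≤ 2 * t * (3 * Real.log n) := by
      gcongr <;> linarith
    linarith
  have hfin : Real.log (((t : ℝ) + 1) * (Nat.log 2 n + 1) + 1) ≤
      (1 + Real.log 7 / Real.log (Real.log 3)) * Real.log (t * Real.log n) := by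
    have h1 := Real.log_le_log (by positivity) harg
    rw [Real.log_mul (by norm_num) (by linarith)] at h1
    have h2 : Real.log (Real.log 3) ≤ Real.log (t * Real.log n) :=
      Real.log_le_log (by linarith) hy
    have h4 : Real.log 7 ≤ Real.log 7 / Real.log (Real.log 3) * Real.log (t * Real.log n) := by
      rw [div_mul_eq_mul_div, le_div_iff₀ hl3]
      gcongr
    linarith
  calc _ ≤ 16 * ((1 + Real.log 7 / Real.log (Real.log 3)) * Real.log (t * Real.log n)) := by
        gcongr
    _ = _ := by field_simp
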